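/- Let S ⊆ ℤ³ be a shape (nonempty, finite, grid-connected) and let c ≥ 1 be an integer. Then the scaled set c·S := {c·p + q : p ∈ S, q ∈ {0,…,c−1}³} is also a shape, i.e. it is nonempty, finite and grid-connected. -/

import Mathlib

/-- Points of the cubic lattice `ℤ³`. -/
abbrev V12 := Fin 3 → ℤ

/-- Two points of `ℤ³` are grid-adjacent if they differ by exactly 1 in one
coordinate and agree in the other two. -/
def gridAdjacent (p q : V12) : Prop :=
  ∃ j, (p j - q j = 1 ∨ q j - p j = 1) ∧ ∀ k, k ≠ j → p k = q k

/-- One step of a grid path staying inside `A`. -/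
def adjIn (A : Set V12) (p q : V12) : Prop :=
  p ∈ A ∧ q ∈ A ∧ gridAdjacent p q

/-- A set is grid-connected if any two of its points are joined by a path of
grid-adjacent points inside the set. -/
def gridConnected (A : Set V12) : Prop :=
  ∀ p ∈ A, ∀ q ∈ A, Relation.ReflTransGen (adjIn A) p q

/-- A shape is a nonempty finite grid-connected subset of `ℤ³`. -/
def IsShape (S : Set V12) : Prop := S.Nonempty ∧ S.Finite ∧ gridConnected S

/-- The scaling of `S` by a factor `c`:
`c·S = {c·p + q : p ∈ S, q ∈ {0,…,c−1}³}`. -/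
def scaleShape (c : ℕ) (S : Set V12) : Set V12 :=
  {x | ∃ p ∈ S, ∃ q : V12, (∀ j, 0 ≤ q j ∧ q j < (c : ℤ)) ∧
    x = fun j => (c : ℤ) * p j + q j}

/-- Any two points of a box contained in `A` are joined by a grid path inside `A`. -/
theorem reflTransGen_adjIn_of_Icc_subset {A : Set V12} {a b : V12} (hA : Set.Icc a b ⊆ A)
    (x y : V12) (hx : x ∈ Set.Icc a b) (hy : y ∈ Set.Icc a b) :
    Relation.ReflTransGen (adjIn A) x y := by
  induction hn : ∑ j, (x j - y j).natAbs using Nat.strong_induction_on generalizing x with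
  | _ n ih =>
    by_cases hxy : x = y
    · rw [hxy]
    obtain ⟨j, hj⟩ := Function.ne_iff.mp hxy
    obtain ⟨t, ht, hlt, hat, htb⟩ : ∃ t : ℤ, (x j - t = 1 ∨ t - x j = 1) ∧
        (t - y j).natAbs < (x j - y j).natAbs ∧ a j ≤ t ∧ t ≤ b j := by
      have h1 : a j ≤ x j := hx.1 j
      have h2 : x j ≤ b j := hx.2 j
      have h3 : a j ≤ y j := hy.1 j
      have h4 : y j ≤ b j := hy.2 j
      rcases lt_or_gt_of_ne hj with h | h
      · exact ⟨x j + 1, by omega, by omega, by omega, by omega⟩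
      · exact ⟨x j - 1, by omega, by omega, by omega, by omega⟩
    have hz : Function.update x j t ∈ Set.Icc a b :=
      ⟨le_update_iff.mpr ⟨hat, fun k _ => hx.1 k⟩, update_le_iff.mpr ⟨htb, fun k _ => hx.2 k⟩⟩
    refine Relation.ReflTransGen.head (b := Function.update x j t) ⟨hA hx, hA hz, j, ?_, ?_⟩
      (ih _ ?_ _ hz rfl)
    · simpa using ht
    · intro k hk
      simp [hk]
    · rw [← hn]
      refine Finset.sum_lt_sum (fun k _ => ?_) ⟨j, Finset.mem_univ j, by simpa using hlt⟩
      by_cases hk : k = j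
      · subst hk
        simpa using hlt.le
      · simp [hk]

/-- A point lies in the scaled set iff its coordinatewise quotient lies in the original set. -/
theorem mem_scaleShape_iff {c : ℕ} (hc : 1 ≤ c) {S : Set V12} {x : V12} :
    x ∈ scaleShape c S ↔ (fun j => x j / (c : ℤ)) ∈ S := by
  have hc0 : (0 : ℤ) < c := by exact_mod_cast hc
  constructor
  · rintro ⟨p, hp, q, hq, rfl⟩
    convert hp using 2 with j
    rw [Int.mul_add_ediv_left _ _ hc0.ne', Int.ediv_eq_zero_of_lt (hq j).1 (hq j).2, add_zero]
  · intro h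
    refine ⟨_, h, fun j => x j % c, fun j => ⟨Int.emod_nonneg _ hc0.ne', Int.emod_lt_of_pos _ hc0⟩,
      ?_⟩
    funext j
    exact (Int.mul_ediv_add_emod _ _).symm

/-- Coordinatewise quotients of points of the box spanned by two cells lie in the interval spanned
by the two points. -/
theorem ediv_mem_Icc {c : ℕ} (hc : 1 ≤ c) {p p' x : V12}
    (hx : x ∈ Set.Icc (fun j => (c : ℤ) * p j) (fun j => (c : ℤ) * p' j + (c - 1))) :
    (fun j => x j / (c : ℤ)) ∈ Set.Icc p p' := by
  have hc0 : (0 : ℤ) < c := by exact_mod_cast hc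
  refine ⟨fun j => ?_, fun j => ?_⟩
  · rw [Int.le_ediv_iff_mul_le hc0, mul_comm]
    exact hx.1 j
  · refine Int.le_of_lt_add_one ((Int.ediv_lt_iff_lt_mul hc0).mpr ?_)
    have := hx.2 j
    simp only at this
    linarith

/-- If the lattice interval from `p` to `p'` lies in `S`, then any two points of the box spanned by
the cells of `p` and `p'` are joined inside the scaled set. -/
theorem reflTransGen_scaleShape {c : ℕ} (hc : 1 ≤ c) {S : Set V12} {p p' : V12}
    (hS : Set.Icc p p' ⊆ S) {x y : V12}
    (hx : x ∈ Set.Icc (fun j => (c : ℤ) * p j) (fun j => (c : ℤ) * p' j + (c - 1)))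
    (hy : y ∈ Set.Icc (fun j => (c : ℤ) * p j) (fun j => (c : ℤ) * p' j + (c - 1))) :
    Relation.ReflTransGen (adjIn (scaleShape c S)) x y :=
  reflTransGen_adjIn_of_Icc_subset
    (fun _ hz => (mem_scaleShape_iff hc).mpr (hS (ediv_mem_Icc hc hz))) x y hx hy

/-- Each point lies in the cell of its coordinatewise quotient. -/
theorem mem_Icc_ediv {c : ℕ} (hc : 1 ≤ c) (x : V12) :
    x ∈ Set.Icc (fun j => (c : ℤ) * (x j / c)) (fun j => (c : ℤ) * (x j / c) + (c - 1)) := by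
  have hc0 : (0 : ℤ) < c := by exact_mod_cast hc
  refine ⟨fun j => ?_, fun j => ?_⟩ <;>
  · have h1 := Int.mul_ediv_add_emod (x j) c
    have h2 := Int.emod_nonneg (x j) hc0.ne'
    have h3 := Int.emod_lt_of_pos (x j) hc0
    simp only
    linarith

/-- An interval whose endpoints differ by one unit step contains only its endpoints. -/
theorem Icc_subset_of_step {S : Set V12} {p p' : V12} (hp : p ∈ S) (hp' : p' ∈ S) {j : Fin 3}
    (hj : p' j - p j = 1) (hk : ∀ k, k ≠ j → p k = p' k) : Set.Icc p p' ⊆ S := by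
  intro x hx
  have hne : ∀ k, k ≠ j → x k = p k := fun k h =>
    le_antisymm ((hx.2 k).trans (hk k h).ge) (hx.1 k)
  have h1 : p j ≤ x j := hx.1 j
  have h2 : x j ≤ p' j := hx.2 j
  rcases (by omega : x j = p j ∨ x j = p' j) with h | h
  · convert hp using 1
    funext k
    by_cases hkj : k = j
    · rw [hkj, h]
    · exact hne k hkj
  · convert hp' using 1
    funext k
    by_cases hkj : k = j
    · rw [hkj, h]
    · rw [hne k hkj, hk k hkj]

/-- Corners of cells of adjacent points are joined inside the scaled set. -/
theorem reflTransGen_corner {c : ℕ} (hc : 1 ≤ c) {S : Set V12} {p p' : V12}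
    (h : adjIn S p p') : Relation.ReflTransGen (adjIn (scaleShape c S))
      (fun j => (c : ℤ) * p j) (fun j => (c : ℤ) * p' j) := by
  have hc0 : (0 : ℤ) ≤ c := Int.natCast_nonneg c
  have hc1 : (1 : ℤ) ≤ c := by exact_mod_cast hc
  have corner_mem : ∀ {r s t : V12}, r ≤ s → s ≤ t → (fun j => (c : ℤ) * s j) ∈
      Set.Icc (fun j => (c : ℤ) * r j) (fun j => (c : ℤ) * t j + (c - 1)) := by
    intro r s t hrs hst
    refine ⟨fun j => mul_le_mul_of_nonneg_left (hrs j) hc0, fun j => ?_⟩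
    have := mul_le_mul_of_nonneg_left (hst j) hc0
    simp only
    linarith
  have le_of_step : ∀ {r s : V12} {j : Fin 3}, s j - r j = 1 → (∀ k, k ≠ j → r k = s k) →
      r ≤ s := by
    intro r s j hj hk k
    by_cases hkj : k = j
    · subst hkj
      exact (by omega : r k ≤ s k)
    · exact (hk k hkj).le
  obtain ⟨hp, hp', j, hj | hj, hk⟩ := h
  · have hk' : ∀ k, k ≠ j → p' k = p k := fun k h => (hk k h).symm
    have hle := le_of_step hj hk'
    exact reflTransGen_scaleShape hc (Icc_subset_of_step hp' hp hj hk')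
      (corner_mem hle le_rfl) (corner_mem le_rfl hle)
  · have hle := le_of_step hj hk
    exact reflTransGen_scaleShape hc (Icc_subset_of_step hp hp' hj hk)
      (corner_mem le_rfl hle) (corner_mem hle le_rfl)

/-- Scaling a shape by a positive integer factor yields a shape. -/
theorem stmt12 (S : Set V12) (hS : IsShape S) (c : ℕ) (hc : 1 ≤ c) :
    IsShape (scaleShape c S) := by
  have hc1 : (1 : ℤ) ≤ c := by exact_mod_cast hc
  obtain ⟨⟨p, hp⟩, hfin, hconn⟩ := hS
  refine ⟨⟨_, p, hp, 0, fun j => ⟨le_rfl, hc1⟩, rfl⟩, ?_, ?_⟩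
  · refine (hfin.biUnion fun p _ => Set.finite_Icc (fun j => (c : ℤ) * p j)
      (fun j => (c : ℤ) * p j + (c - 1))).subset fun x hx => ?_
    exact Set.mem_biUnion ((mem_scaleShape_iff hc).mp hx) (mem_Icc_ediv hc x)
  · intro x hx y hy
    rw [mem_scaleShape_iff hc] at hx hy
    have single : ∀ {r : V12}, r ∈ S → Set.Icc r r ⊆ S := by
      intro r hr
      simpa using hr
    have corner : ∀ r : V12, (fun j => (c : ℤ) * r j) ∈
        Set.Icc (fun j => (c : ℤ) * r j) (fun j => (c : ℤ) * r j + (c - 1)) := fun r =>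
      ⟨le_rfl, fun j => le_add_of_nonneg_right (sub_nonneg.mpr hc1)⟩
    refine (reflTransGen_scaleShape hc (single hx) (mem_Icc_ediv hc x) (corner _)).trans
      (Relation.ReflTransGen.trans ?_
        (reflTransGen_scaleShape hc (single hy) (corner _) (mem_Icc_ediv hc y)))
    exact (Relation.ReflTransGen.lift' (fun (r : V12) j => (c : ℤ) * r j)
      (fun _ _ h => reflTransGen_corner hc h)) _ _ (hconn _ hx _ hy)
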